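/- With notation as before (A invertible, A^t = εA, B^t = εB, B ≡ A mod p, C = (B−A)/p, Λ = (1 + pA^{−1}C)^{1/2} the principal square root), one has (AΛ)^t = ε·AΛ; that is, AΛ is symmetric when ε = 1 and antisymmetric when ε = −1. -/

import Mathlib

open Matrix

/-- If `A * X = Xᵀ * A`, then the same relation holds for every polynomial in `X`. -/
theorem Matrix.mul_aeval_eq_transpose_aeval_mul {R ι : Type*} [CommRing R] [Fintype ι]
    [DecidableEq ι] {A X : Matrix ι ι R} (h : A * X = Xᵀ * A) (P : Polynomial R) :
    A * Polynomial.aeval X P = (Polynomial.aeval X P)ᵀ * A := by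
  have hpow (k : ℕ) : A * X ^ k = (X ^ k)ᵀ * A := by
    rw [Matrix.transpose_pow]
    exact SemiconjBy.pow_right (a := A) h k
  induction P using Polynomial.induction_on' with
  | add P Q hP hQ => simp only [map_add, transpose_add, mul_add, add_mul, hP, hQ]
  | monomial k a =>
    simp only [Polynomial.aeval_monomial, ← Algebra.smul_def, transpose_smul, mul_smul_comm,
      smul_mul_assoc, hpow]

/-- With `Aᵗ = εA`, `Bᵗ = εB` (`ε = ±1`), `A` invertible, `B ≡ A (mod p)`,
`C = (B−A)/p`, and `Λ = (1+pA⁻¹C)^{1/2}` the principal square root (`Λ ≡ 1 mod p`,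
`Λ² = A⁻¹B`, `Λ` a `p`-adic limit of polynomials in `A⁻¹C`), one has `(AΛ)ᵗ = ε·AΛ`. -/
theorem stmt_10 (p : ℕ) (hp : p.Prime) (hodd : Odd p) (R : Type*) [CommRing R]
    (htf : ∀ a : R, (p : R) * a = 0 → a = 0)
    (hsep : ∀ a : R, (∀ m : ℕ, (p : R) ^ m ∣ a) → a = 0)
    (n : ℕ) (ε : R) (hε : ε = 1 ∨ ε = -1)
    (A B C Λ : Matrix (Fin n) (Fin n) R)
    (hA : IsUnit A.det) (hAt : Aᵀ = ε • A) (hBt : Bᵀ = ε • B)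
    (hC : (p : R) • C = B - A)
    (hΛ1 : ∀ i j, (p : R) ∣ (Λ - 1) i j)
    (hΛsq : Λ * Λ = A⁻¹ * B)
    (hΛpoly : ∀ m : ℕ, ∃ P : Polynomial R,
        ∀ i j, (p : R) ^ m ∣ (Λ - Polynomial.aeval (A⁻¹ * C) P) i j) :
    (A * Λ)ᵀ = ε • (A * Λ) := by
  have hεε : ε * ε = 1 := by rcases hε with rfl | rfl <;> simp
  have hCt : Cᵀ = ε • C := by
    ext i j
    have hent (i j : Fin n) : (p : R) * C i j = B i j - A i j := congrFun₂ hC i j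
    have hAij : A j i = ε * A i j := congrFun₂ hAt i j
    have hBij : B j i = ε * B i j := congrFun₂ hBt i j
    refine sub_eq_zero.mp (htf _ ?_)
    simp only [transpose_apply, Matrix.smul_apply, smul_eq_mul]
    linear_combination hent j i - ε * hent i j + hBij - hAij
  have hX : A * (A⁻¹ * C) = (A⁻¹ * C)ᵀ * A := by
    have hinv : A⁻¹ᵀ * A = ε • 1 := by
      have hA' : A = ε • Aᵀ := by rw [hAt, smul_smul, hεε, one_smul]
      conv_lhs => rw [hA', mul_smul_comm, ← hA', ← transpose_mul]
      rw [mul_nonsing_inv A hA, transpose_one]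
    rw [mul_nonsing_inv_cancel_left A C hA, transpose_mul, mul_assoc, hinv, hCt]
    simp [smul_smul, hεε]
  have hcomm : A * Λ = Λᵀ * A := by
    ext i j
    refine sub_eq_zero.mp (hsep _ fun m => ?_)
    obtain ⟨P, hP⟩ := hΛpoly m
    have hAP := mul_aeval_eq_transpose_aeval_mul hX P
    set Y := Polynomial.aeval (A⁻¹ * C) P
    have hdiff : A * Λ - Λᵀ * A = A * (Λ - Y) - (Λ - Y)ᵀ * A := by
      rw [transpose_sub, mul_sub, sub_mul, hAP]
      abel
    rw [← Matrix.sub_apply, hdiff, Matrix.sub_apply, mul_apply, mul_apply]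
    exact dvd_sub (Finset.dvd_sum fun k _ => (hP k j).mul_left _)
      (Finset.dvd_sum fun k _ => (hP k i).mul_right _)
  rw [transpose_mul, hAt, mul_smul_comm, hcomm]
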